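/- Let f : 𝕋² → 𝕋² be a homeomorphism homotopic to the identity with lift F, and suppose that for every ε > 0 there is a periodic ε-chain for F (a sequence x₁, …, xₙ in ℝ² with n ≥ 2, x₁ = xₙ, and dist(F(xᵢ), x_{i+1}) < ε for all i). Then F has a fixed point, and hence f has a fixed point z with F(z̃) = z̃ for some lift z̃ of z, so ρ(z̃, F) = 0. -/

import Mathlib

open Filter Topology

def IsTorusLift (F : ℝ × ℝ → ℝ × ℝ) : Prop :=
  ∀ (x : ℝ × ℝ) (m : ℤ × ℤ),
    F (x + ((m.1 : ℝ), (m.2 : ℝ))) = F x + ((m.1 : ℝ), (m.2 : ℝ))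

abbrev Torus2 := AddCircle (1 : ℝ) × AddCircle (1 : ℝ)

noncomputable def torusProj (x : ℝ × ℝ) : Torus2 := ((x.1 : AddCircle (1 : ℝ)), (x.2 : AddCircle (1 : ℝ)))

theorem exists_continuous_exp_eq {A : Type*} [TopologicalSpace A] [SimplyConnectedSpace A]
    [LocallyPathConnectedSpace A] {f : A → ℂ} (hf : Continuous f) (h0 : ∀ a, f a ≠ 0) :
    ∃ g : A → ℂ, Continuous g ∧ ∀ a, Complex.exp (g a) = f a := by
  obtain ⟨a₀⟩ : Nonempty A := inferInstance
  let f' : C(A, {z : ℂ // z ≠ 0}) := ⟨fun a ↦ ⟨f a, h0 a⟩, by fun_prop⟩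
  obtain ⟨g, ⟨-, hg⟩, -⟩ := Complex.isCoveringMap_exp.existsUnique_continuousMap_lifts f' a₀
    (Complex.log (f a₀)) (Subtype.ext (Complex.exp_log (h0 a₀)))
  exact ⟨g, g.continuous, fun a ↦ congrArg Subtype.val (congrFun hg a)⟩

theorem sub_eq_sub_of_exp_eq {A : Type*} [TopologicalSpace A] [PreconnectedSpace A]
    {g₁ g₂ : A → ℂ} (h₁ : Continuous g₁) (h₂ : Continuous g₂)
    (h : ∀ a, Complex.exp (g₁ a) = Complex.exp (g₂ a)) (a b : A) :
    g₁ a - g₂ a = g₁ b - g₂ b := by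
  have hb : Complex.exp (g₁ b - g₂ b) = 1 := by
    rw [Complex.exp_sub, h b, div_self (Complex.exp_ne_zero _)]
  have := Complex.isCoveringMap_exp.eq_of_comp_eq h₁
    (show Continuous fun a ↦ g₂ a + (g₁ b - g₂ b) by fun_prop)
    (funext fun x ↦ Subtype.ext (by simp [Complex.exp_add, hb, h x])) b (by ring)
  rw [this]; ring

theorem exp_add_pi_mul_I (w : ℂ) :
    Complex.exp (w + Real.pi * Complex.I) = -Complex.exp w := by
  rw [Complex.exp_add, Complex.exp_pi_mul_I]; ring

/-- A lift of the relative rotation of pairs of points under a homeomorphism of the plane at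
bounded distance from the identity is a function of the unordered pair. -/
theorem log_slope_symm {G : ℂ ≃ₜ ℂ} {C : ℝ} (hC : ∀ z, ‖G z - z‖ ≤ C)
    {L : ℂ × ℂ → ℂ} (hL : Continuous L)
    (hexp : ∀ x w, Complex.exp (L (x, w)) = (G (x + Complex.exp w) - G x) / Complex.exp w)
    (x w : ℂ) : L (x + Complex.exp w, w + Real.pi * Complex.I) = L (x, w) := by
  have hper : ∀ x w, L (x, w + Real.pi * Complex.I + Real.pi * Complex.I) = L (x, w) := by
    obtain ⟨R, hR⟩ : ∃ R : ℝ, 2 * C < Real.exp R :=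
      ⟨2 * C, by linarith [Real.add_one_le_exp (2 * C)]⟩
    have hslit : ∀ t : ℝ, Complex.exp (L (0, R + t * Complex.I)) ∈ Complex.slitPlane := by
      intro t
      refine Complex.mem_slitPlane_of_norm_lt_one (z := _ - 1) ?_ |> fun h ↦ by simpa using h
      rw [hexp, div_sub_one (Complex.exp_ne_zero _), norm_div, Complex.norm_exp,
        div_lt_one (Real.exp_pos _)]
      set v := Complex.exp (R + t * Complex.I)
      have h1 := hC (0 + v)
      have h2 := hC 0
      have : G (0 + v) - G 0 - v = (G (0 + v) - (0 + v)) - (G 0 - 0) := by ring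
      rw [this]
      refine (norm_sub_le _ _).trans_lt ?_
      simp only [add_zero, zero_add, sub_zero, Complex.add_re, Complex.ofReal_re,
        Complex.re_ofReal_mul, Complex.I_re, mul_zero] at h1 h2 ⊢
      linarith
    have hlog := sub_eq_sub_of_exp_eq (A := ℝ)
      (g₁ := fun t ↦ L (0, R + t * Complex.I))
      (g₂ := fun t ↦ Complex.log (Complex.exp (L (0, R + t * Complex.I))))
      (by fun_prop) (Continuous.clog (by fun_prop) hslit)
      (fun t ↦ (Complex.exp_log (Complex.exp_ne_zero _)).symm) (Real.pi + Real.pi) 0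
    have key := sub_eq_sub_of_exp_eq (A := ℂ × ℂ)
      (g₁ := fun p ↦ L (p.1, p.2 + Real.pi * Complex.I + Real.pi * Complex.I)) (g₂ := L)
      (by fun_prop) hL (by rintro ⟨a, b⟩; simp only [hexp, exp_add_pi_mul_I, neg_neg])
    intro x w
    have h0 := key (x, w) (0, R)
    have hR' : (R : ℂ) + ((Real.pi + Real.pi : ℝ) : ℂ) * Complex.I
        = R + Real.pi * Complex.I + Real.pi * Complex.I := by push_cast; ring
    simp only [hR', hexp, exp_add_pi_mul_I, neg_neg] at hlog
    simp only [Complex.ofReal_zero, zero_mul, add_zero, sub_left_inj] at hlog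
    simp only [hlog, sub_self] at h0
    exact sub_eq_zero.mp h0
  have key := sub_eq_sub_of_exp_eq (A := ℂ × ℂ)
      (g₁ := fun p ↦ L (p.1 + Complex.exp p.2, p.2 + Real.pi * Complex.I)) (g₂ := L)
      (by fun_prop) hL (by
        rintro ⟨a, b⟩
        simp only [hexp, exp_add_pi_mul_I, add_neg_cancel_right]
        rw [← neg_sub, neg_div_neg_eq])
      (x, w) (x + Complex.exp w, w + Real.pi * Complex.I)
  simp only [exp_add_pi_mul_I, add_neg_cancel_right, hper] at key
  linear_combination key / 2

theorem apply_apply_ne_of_forall_ne {G : ℂ ≃ₜ ℂ} {C : ℝ} (hC : ∀ z, ‖G z - z‖ ≤ C)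
    (hfix : ∀ z, G z ≠ z) (p : ℂ) : G (G p) ≠ p := by
  intro hp
  obtain ⟨θ, hθ, hθe⟩ := exists_continuous_exp_eq (f := fun z ↦ G z - z) (by fun_prop)
    fun z ↦ sub_ne_zero.mpr (hfix z)
  obtain ⟨L, hL, hexp⟩ := exists_continuous_exp_eq (A := ℂ × ℂ)
    (f := fun q ↦ (G (q.1 + Complex.exp q.2) - G q.1) / Complex.exp q.2)
    (by
      refine Continuous.div (by fun_prop) (by fun_prop) fun q ↦ Complex.exp_ne_zero _)
    (fun q ↦ div_ne_zero (sub_ne_zero.mpr fun h ↦ by simpa using G.injective h)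
      (Complex.exp_ne_zero _))
  have hsymm := log_slope_symm hC hL fun x w ↦ hexp (x, w)
  have hGθ : ∀ z, z + Complex.exp (θ z) = G z := fun z ↦ by rw [hθe]; ring
  have hdisp := sub_eq_sub_of_exp_eq (g₁ := fun z ↦ L (z, θ z)) (g₂ := fun z ↦ θ (G z) - θ z)
    (by fun_prop) (by fun_prop)
    (fun z ↦ by simp only [hexp, Complex.exp_sub, hθe, add_sub_cancel]) p (G p)
  have hn : ∃ n : ℤ, θ (G p) = θ p + Real.pi * Complex.I + n * (2 * Real.pi * Complex.I) := by
    rw [← Complex.exp_eq_exp_iff_exists_int, exp_add_pi_mul_I, hθe, hθe, hp]; ring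
  have hL' : L (G p, θ (G p)) = L (p, θ p) := by
    obtain ⟨n, hn⟩ := hn
    have hper : Function.Periodic (fun w ↦ L (G p, w)) (2 * Real.pi * Complex.I) := by
      intro w
      have h1 := hsymm (G p) w
      have h2 := hsymm (G p + Complex.exp w) (w + Real.pi * Complex.I)
      rw [exp_add_pi_mul_I, add_neg_cancel_right, h1] at h2
      simp only
      rw [← h2]; congr 2; ring
    rw [hn]
    refine (hper.int_mul n _).trans ?_
    rw [← hsymm p, hGθ]
  have hθ' : θ (G p) = θ p := by
    simp only [hL', hp] at hdisp
    linear_combination -hdisp / 2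
  have h1 := hθe (G p)
  rw [hθ', hθe, hp] at h1
  exact hfix p (by linear_combination h1 / 2)

/-- A homeomorphism at bounded distance from the identity, without fixed points. -/
structure IsBoundedFree {E : Type*} [NormedAddCommGroup E] (G : E ≃ₜ E) : Prop where
  bounded : ∃ C : ℝ, ∀ z, ‖G z - z‖ ≤ C
  apply_ne : ∀ z, G z ≠ z

/-- Some homeomorphism supported in `U` and at bounded distance from the identity sends `p` to
`q`. -/
def CanPush {E : Type*} [NormedAddCommGroup E] (U : Set E) (p q : E) : Prop :=
  ∃ h : E ≃ₜ E, h p = q ∧ (∀ z ∉ U, h z = z) ∧ ∃ C : ℝ, ∀ z, ‖h z - z‖ ≤ C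

section Push

variable {E : Type*} [NormedAddCommGroup E] {U V : Set E} {p q s : E}

theorem CanPush.trans (h₁ : CanPush U p q) (h₂ : CanPush U q s) : CanPush U p s := by
  obtain ⟨f, hf, hfU, C, hC⟩ := h₁
  obtain ⟨g, hg, hgU, D, hD⟩ := h₂
  refine ⟨f.trans g, by simp [hf, hg], fun z hz ↦ by simp [hfU z hz, hgU z hz], D + C,
    fun z ↦ ?_⟩
  exact (norm_sub_le_norm_sub_add_norm_sub _ (f z) _).trans (add_le_add (hD _) (hC _))

theorem CanPush.symm (h₁ : CanPush U p q) : CanPush U q p := by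
  obtain ⟨f, hf, hfU, C, hC⟩ := h₁
  refine ⟨f.symm, by simp [← hf], fun z hz ↦ ?_, C, fun z ↦ ?_⟩
  · rw [Homeomorph.symm_apply_eq, hfU z hz]
  · simpa [norm_sub_rev] using hC (f.symm z)

theorem CanPush.mono (h₁ : CanPush U p q) (hUV : U ⊆ V) : CanPush V p q := by
  obtain ⟨f, hf, hfU, hC⟩ := h₁
  exact ⟨f, hf, fun z hz ↦ hfU z fun h ↦ hz (hUV h), hC⟩

variable [NormedSpace ℝ E] [CompleteSpace E]

theorem canPush_ball {r : ℝ} (hq : q ∈ Metric.ball p r) : CanPush (Metric.ball p r) p q := by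
  obtain ⟨v, rfl⟩ : ∃ v, q = p + v := ⟨q - p, by abel⟩
  have hv : ‖v‖ < r := by simpa using hq
  have hr : 0 < r := (norm_nonneg v).trans_lt hv
  let f : E → E := fun z ↦ z + max 0 (1 - ‖z - p‖ / r) • v
  let c : NNReal := ⟨‖v‖ / r, by positivity⟩
  have hc : c < 1 := by
    rw [← NNReal.coe_lt_coe]; exact (div_lt_one hr).mpr hv
  have hf : ApproximatesLinearOn f
      ((ContinuousLinearEquiv.refl ℝ E : E ≃L[ℝ] E) : E →L[ℝ] E) Set.univ c := by
    intro x _ y _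
    have h1 : f x - f y - (x - y) = (max 0 (1 - ‖x - p‖ / r) - max 0 (1 - ‖y - p‖ / r)) • v := by
      simp only [f, sub_smul]; abel
    simp only [ContinuousLinearEquiv.coe_coe, ContinuousLinearEquiv.refl_apply, h1, norm_smul]
    have h2 : ‖max 0 (1 - ‖x - p‖ / r) - max 0 (1 - ‖y - p‖ / r)‖ ≤ ‖x - y‖ / r := by
      rw [Real.norm_eq_abs, max_comm 0, max_comm 0]
      refine (abs_max_sub_max_le_abs _ _ 0).trans ?_
      rw [show 1 - ‖x - p‖ / r - (1 - ‖y - p‖ / r) = -((‖x - p‖ - ‖y - p‖) / r) by ring, abs_neg,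
        abs_div, abs_of_pos hr]
      gcongr
      simpa using abs_norm_sub_norm_le (x - p) (y - p)
    calc _ ≤ ‖x - y‖ / r * ‖v‖ := by gcongr
      _ = c * ‖x - y‖ := by change _ = ‖v‖ / r * ‖x - y‖; ring
  have hc' : Subsingleton E ∨ c < ‖((ContinuousLinearEquiv.refl ℝ E).symm : E →L[ℝ] E)‖₊⁻¹ := by
    rcases subsingleton_or_nontrivial E with h | h
    · exact .inl h
    · right
      have : ‖((ContinuousLinearEquiv.refl ℝ E).symm : E →L[ℝ] E)‖₊ = 1 := by
        ext; exact ContinuousLinearMap.norm_id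
      simpa [this] using hc
  have happ : ∀ z, hf.toHomeomorph f hc' z = z + max 0 (1 - ‖z - p‖ / r) • v := fun z ↦ rfl
  refine ⟨hf.toHomeomorph f hc', by simp [happ], fun z hz ↦ ?_, ‖v‖, fun z ↦ ?_⟩
  · have : r ≤ ‖z - p‖ := by simpa [dist_eq_norm] using hz
    rw [happ, max_eq_left, zero_smul, add_zero]
    rw [sub_nonpos, le_div_iff₀ hr]; linarith
  · rw [happ, add_sub_cancel_left, norm_smul, Real.norm_eq_abs, abs_of_nonneg (le_max_left _ _)]
    refine mul_le_of_le_one_left (norm_nonneg _) (max_le zero_le_one ?_)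
    have : 0 ≤ ‖z - p‖ / r := by positivity
    linarith

theorem canPush_of_isPreconnected (hU : IsOpen U) (hUc : IsPreconnected U) (hp : p ∈ U)
    (hq : q ∈ U) : CanPush U p q := by
  refine hUc.induction₂ (CanPush U) (fun x hx ↦ ?_) (fun _ _ _ _ _ _ ↦ CanPush.trans)
    (fun _ _ _ _ ↦ CanPush.symm) hp hq
  obtain ⟨r, hr, hrU⟩ := Metric.isOpen_iff.mp hU x hx
  filter_upwards [mem_nhdsWithin_of_mem_nhds (Metric.ball_mem_nhds x hr)] with y hy
  exact (canPush_ball hy).mono hrU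

theorem IsBoundedFree.exists_push {G : E ≃ₜ E} (hG : IsBoundedFree G) (hU : IsOpen U)
    (hUc : IsPreconnected U) (hfree : ∀ z ∈ U, G z ∉ U) (hp : p ∈ U) (hq : q ∈ U) :
    ∃ h : E ≃ₜ E, h p = q ∧ (∀ z ∉ U, h z = z) ∧ IsBoundedFree (G.trans h) := by
  obtain ⟨h, hpq, hhU, D, hD⟩ := canPush_of_isPreconnected hU hUc hp hq
  obtain ⟨C, hC⟩ := hG.bounded
  refine ⟨h, hpq, hhU, ⟨D + C, fun z ↦ ?_⟩, fun z hz ↦ ?_⟩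
  · exact (norm_sub_le_norm_sub_add_norm_sub _ (G z) _).trans (add_le_add (hD _) (hC _))
  · simp only [Homeomorph.trans_apply] at hz
    by_cases hGz : G z ∈ U
    · refine hfree z ?_ hGz
      by_contra hzU
      have : G z = z := h.injective (by rw [hz, hhU z hzU])
      exact hzU (this ▸ hGz)
    · exact hG.apply_ne z (by rw [← hhU _ hGz, hz])

theorem IsBoundedFree.iterate_notMem {G : E ≃ₜ E} {n : ℕ} (hG : IsBoundedFree G)
    (hmin : ∀ G' : E ≃ₜ E, IsBoundedFree G' → ∀ k, 0 < k → k < n → ∀ z, G'^[k] z ≠ z)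
    (hU : IsOpen U) (hUc : IsPreconnected U) (hfree : ∀ z ∈ U, G z ∉ U) {i : ℕ} (hi : 0 < i)
    (hin : i < n) {z : E} (hz : z ∈ U) : G^[i] z ∉ U := by
  classical
  intro hiz
  have hex : ∃ k, 0 < k ∧ G^[k] z ∈ U := ⟨i, hi, hiz⟩
  obtain ⟨hk, hkU⟩ := Nat.find_spec hex
  have hki : Nat.find hex ≤ i := Nat.find_min' hex ⟨hi, hiz⟩
  have hlt : ∀ j, 0 < j → j < Nat.find hex → G^[j] z ∉ U := fun j hj hjk h ↦
    Nat.find_min hex hjk ⟨hj, h⟩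
  generalize Nat.find hex = k at *
  obtain ⟨h, hh, hhU, hG'⟩ := hG.exists_push hU hUc hfree hkU hz
  have hiter : ∀ j < k, (G.trans h)^[j] z = G^[j] z := by
    intro j
    induction j with
    | zero => simp
    | succ j ih =>
      intro hj
      rw [Function.iterate_succ_apply', ih (by omega), Homeomorph.trans_apply,
        ← Function.iterate_succ_apply' G, hhU _ (hlt _ (by omega) hj)]
  obtain ⟨k, rfl⟩ := Nat.exists_eq_succ_of_ne_zero hk.ne'
  refine hmin _ hG' (k + 1) hk (by omega) z ?_
  rw [Function.iterate_succ_apply', hiter k (by omega), Homeomorph.trans_apply,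
    ← Function.iterate_succ_apply' G, hh]

end Push

theorem isCompact_segment {E : Type*} [NormedAddCommGroup E] [NormedSpace ℝ E] (a b : E) :
    IsCompact (segment ℝ a b) := by
  rw [← Path.range_segment a b]
  exact isCompact_range (Path.segment a b).continuous

theorem exists_isPreconnected_free {E : Type*} [NormedAddCommGroup E] [NormedSpace ℝ E]
    {G : E ≃ₜ E} {β N : Set E} (hβ : IsCompact β) (hβc : IsPreconnected β) (hN : IsOpen N)
    (hβN : β ⊆ N) (hfree : ∀ z ∈ β, G z ∉ β) :
    ∃ U, IsOpen U ∧ IsPreconnected U ∧ β ⊆ U ∧ U ⊆ N ∧ ∀ z ∈ U, G z ∉ U := by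
  rcases β.eq_empty_or_nonempty with rfl | ⟨x, hx⟩
  · exact ⟨∅, isOpen_empty, isPreconnected_empty, by simp⟩
  obtain ⟨O₁, O₂, hO₁, hO₂, h₁, h₂, hdisj⟩ :=
    SeparatedNhds.of_isCompact_isClosed hβ (hβ.image G.continuous).isClosed
      (Set.disjoint_right.mpr (by rintro _ ⟨z, hz, rfl⟩; exact hfree z hz))
  let W := O₁ ∩ G ⁻¹' O₂ ∩ N
  have hW : IsOpen W := (hO₁.inter (hO₂.preimage G.continuous)).inter hN
  have hβW : β ⊆ W := fun z hz ↦ ⟨⟨h₁ hz, h₂ ⟨z, hz, rfl⟩⟩, hβN hz⟩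
  have hUW := connectedComponentIn_subset W x
  refine ⟨connectedComponentIn W x, hW.connectedComponentIn, isPreconnected_connectedComponentIn,
    hβc.subset_connectedComponentIn hx hβW, fun z hz ↦ (hUW hz).2, fun z hz hGz ↦ ?_⟩
  exact Set.disjoint_left.mp hdisj (hUW hGz).1.1 (hUW hz).1.2

theorem mem_sphere_of_forall_notMem_ball {E : Type*} [NormedAddCommGroup E] [NormedSpace ℝ E]
    {H : E → E} (hH : Continuous H) (hHo : IsOpenMap H) {c : E} {r : ℝ} (hr : r ≠ 0)
    (hfree : ∀ z ∈ Metric.ball c r, H z ∉ Metric.ball c r) {z : E}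
    (hz : z ∈ Metric.closedBall c r) (hHz : H z ∈ Metric.closedBall c r) :
    z ∈ Metric.sphere c r ∧ H z ∈ Metric.sphere c r := by
  constructor
  · by_contra h
    have hzb : z ∈ Metric.ball c r := lt_of_le_of_ne hz h
    rw [← closure_ball c hr, mem_closure_iff] at hHz
    obtain ⟨_, ⟨w, hw, rfl⟩, hwb⟩ :=
      hHz _ (hHo _ Metric.isOpen_ball) (Set.mem_image_of_mem H hzb)
    exact hfree w hw ‹_›
  · by_contra h
    have hzb : H z ∈ Metric.ball c r := lt_of_le_of_ne hHz h
    rw [← closure_ball c hr, mem_closure_iff] at hz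
    obtain ⟨w, hw, hwb⟩ := hz _ (Metric.isOpen_ball.preimage hH) hzb
    exact hfree w hwb hw

theorem exists_ball_touching_image {E : Type*} [NormedAddCommGroup E] [NormedSpace ℝ E]
    [ProperSpace E] {G : E ≃ₜ E} (hfix : ∀ z, G z ≠ z) (c : E) :
    ∃ r > 0, (∀ z ∈ Metric.ball c r, G z ∉ Metric.ball c r) ∧
      ∃ y, y ∈ Metric.sphere c r ∧ G y ∈ Metric.sphere c r := by
  have hcont : Continuous fun z ↦ max (dist z c) (dist (G z) c) := by fun_prop
  obtain ⟨y, hy⟩ := hcont.exists_forall_le (tendsto_atTop_mono (fun z ↦ le_max_left _ _)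
    (tendsto_dist_right_cocompact_atTop c))
  set r := max (dist y c) (dist (G y) c)
  have hr0 : 0 < r := by
    rcases eq_or_ne y c with rfl | h
    · exact lt_max_of_lt_right (dist_pos.mpr (hfix y))
    · exact lt_max_of_lt_left (dist_pos.mpr h)
  have hfree : ∀ z ∈ Metric.ball c r, G z ∉ Metric.ball c r := fun z hz hGz ↦
    (max_lt (Metric.mem_ball.mp hz) (Metric.mem_ball.mp hGz)).not_ge (hy z)
  exact ⟨r, hr0, hfree, y, mem_sphere_of_forall_notMem_ball G.continuous G.isOpenMap hr0.ne' hfree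
    (Metric.mem_closedBall.mpr (le_max_left _ _)) (Metric.mem_closedBall.mpr (le_max_right _ _))⟩

/-- A periodic orbit of period at least three can be shortened by a perturbation which creates no
fixed point. -/
theorem IsBoundedFree.iterate_ne_of_forall_lt {E : Type*} [NormedAddCommGroup E] [NormedSpace ℝ E]
    [ProperSpace E] {G : E ≃ₜ E} (hG : IsBoundedFree G) {n : ℕ} (hn : 3 ≤ n)
    (hmin : ∀ G' : E ≃ₜ E, IsBoundedFree G' → ∀ k, 0 < k → k < n → ∀ z, G'^[k] z ≠ z) (x : E) :
    G^[n] x ≠ x := by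
  intro hper
  obtain ⟨r, hr, hfree, y, hy, hGy⟩ := exists_ball_touching_image hG.apply_ne x
  have hxb : x ∈ Metric.ball x r := Metric.mem_ball_self hr
  have hxc := Metric.ball_subset_closedBall hxb
  have hopen : ∀ i, IsOpenMap G^[i] := fun i ↦ by
    induction i with
    | zero => exact IsOpenMap.id
    | succ i ih => rw [Function.iterate_succ]; exact ih.comp G.isOpenMap
  have hsph : ∀ i, 0 < i → i < n → ∀ z ∈ Metric.closedBall x r, G^[i] z ∈ Metric.closedBall x r →
      z ∈ Metric.sphere x r ∧ G^[i] z ∈ Metric.sphere x r := fun i hi hin z hz ↦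
    mem_sphere_of_forall_notMem_ball (G.continuous.iterate i) (hopen i) hr.ne'
      (fun w hw ↦ hG.iterate_notMem hmin Metric.isOpen_ball
        (convex_ball x r).isPreconnected hfree hi hin hw) hz
  have hxn : ∀ i, 0 < i → i < n → G^[i] x ∉ Metric.closedBall x r := fun i hi hin h ↦ by
    have := (hsph i hi hin x hxc h).1
    simp [hr.ne] at this
  have hsphere : ∀ w ∈ Metric.sphere x r, ∀ z ∈ segment ℝ x w, z ∈ Metric.sphere x r → z = w := by
    intro w hw z hz hzs
    obtain ⟨t, ⟨ht0, ht1⟩, rfl⟩ := (segment_eq_image' ℝ x w ▸ hz)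
    have : t * r = r := by
      simpa [norm_smul, abs_of_nonneg ht0, dist_eq_norm, mem_sphere_iff_norm.mp hw] using hzs
    have : t = 1 := mul_right_cancel₀ hr.ne' (this.trans (one_mul r).symm)
    simp [this]
  have hseg : ∀ w ∈ Metric.sphere x r, segment ℝ x w ⊆ Metric.closedBall x r := fun w hw ↦
    (convex_closedBall x r).segment_subset hxc (Metric.sphere_subset_closedBall hw)
  have hconn : ∀ a b : E, IsPreconnected (segment ℝ a b) := fun a b ↦
    (convex_segment a b).isPreconnected
  set α := segment ℝ x (G y) ∪ G '' segment ℝ x y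
  have hαc : IsCompact α := (isCompact_segment _ _).union ((isCompact_segment _ _).image G.continuous)
  have hGxα : G x ∈ α := .inr ⟨x, left_mem_segment ℝ x y, rfl⟩
  have horb : ∀ i, 2 ≤ i → i < n → G^[i] x ∉ α := by
    rintro i hi hin (h | ⟨z, hz, hzi⟩)
    · exact hxn i (by omega) hin (hseg _ hGy h)
    · obtain ⟨j, rfl⟩ : ∃ j, i = j + 1 := ⟨i - 1, by omega⟩
      rw [Function.iterate_succ_apply', G.injective.eq_iff] at hzi
      exact hxn j (by omega) (by omega) (hzi ▸ hseg _ hy hz)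
  let K : Set E := (fun i ↦ G^[i] x) '' Set.Ico 2 n
  have hK : IsClosed K := ((Set.finite_Ico 2 n).image _).isClosed
  obtain ⟨N, O, hN, hO, hαN, hKO, hNO⟩ := SeparatedNhds.of_isCompact_isClosed hαc hK
    (Set.disjoint_right.mpr (by rintro _ ⟨i, ⟨hi, hin⟩, rfl⟩; exact horb i hi hin))
  rw [Set.disjoint_left] at hNO
  have hGGx : G (G x) ∈ O := hKO ⟨2, ⟨le_rfl, by omega⟩, rfl⟩
  obtain ⟨ρ, hρ, hρE⟩ := Metric.isOpen_iff.mp (hN.inter (hO.preimage G.continuous)) (G x)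
    ⟨hαN hGxα, hGGx⟩
  obtain ⟨q, hqy, hqx, hqE⟩ : ∃ q ∈ segment ℝ x y, q ≠ x ∧ G q ∈ Metric.ball (G x) ρ := by
    have hc : ContinuousAt (fun t : ℝ ↦ G (x + t • (y - x))) 0 := by fun_prop
    have hev : ∀ᶠ t : ℝ in 𝓝[>] 0, G (x + t • (y - x)) ∈ Metric.ball (G x) ρ :=
      nhdsWithin_le_nhds (hc (by simpa using Metric.ball_mem_nhds (G x) hρ))
    obtain ⟨t, ht, ht0, ht1⟩ := (hev.and (Ioc_mem_nhdsGT one_pos)).exists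
    refine ⟨x + t • (y - x), ?_, ?_, ht⟩
    · rw [segment_eq_image']; exact ⟨t, ⟨ht0.le, ht1⟩, rfl⟩
    · have : y ≠ x := Metric.ne_of_mem_sphere hy hr.ne'
      simp [ht0.ne', sub_ne_zero.mpr this]
  have hTy : segment ℝ y q ⊆ segment ℝ x y :=
    (convex_segment x y).segment_subset (right_mem_segment ℝ x y) hqy
  have hTS : ∀ z ∈ segment ℝ y q, z ∉ segment ℝ x (G y) := by
    intro z hz hzS
    rw [segment_eq_image'] at hqy hzS
    obtain ⟨s, ⟨hs0, hs1⟩, rfl⟩ := hqy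
    obtain ⟨t, ⟨ht0, ht1⟩, rfl⟩ := hzS
    have hs : 0 < s := lt_of_le_of_ne hs0 (by rintro rfl; simp at hqx)
    obtain ⟨u, ⟨hu0, hu1⟩, huz⟩ := (segment_eq_image' ℝ y _ ▸ hz)
    have hc : (1 - u + u * s) • (y - x) = t • (G y - x) := by
      have h1 : y + u • (x + s • (y - x) - y) - x = (1 - u + u * s) • (y - x) := by
        module
      rw [← h1]
      simp only at huz
      rw [huz]; abel
    have hpos : 0 < 1 - u + u * s := by nlinarith [mul_nonneg hu0 hs0]
    have hnorm := congrArg norm hc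
    rw [norm_smul, norm_smul, mem_sphere_iff_norm.mp hy, mem_sphere_iff_norm.mp hGy,
      Real.norm_of_nonneg hpos.le, Real.norm_of_nonneg ht0] at hnorm
    have hts := mul_right_cancel₀ hr.ne' hnorm
    rw [← hts] at hc
    exact hG.apply_ne y (sub_left_injective (smul_right_injective E hpos.ne' hc)).symm
  set β := segment ℝ x (G y) ∪ G '' segment ℝ y q
  have hβc : IsCompact β := (isCompact_segment _ _).union ((isCompact_segment _ _).image G.continuous)
  have hβp : IsPreconnected β := (hconn _ _).union (G y) (right_mem_segment ℝ _ _)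
    ⟨y, left_mem_segment ℝ _ _, rfl⟩ ((hconn _ _).image G G.continuous.continuousOn)
  have hβN : β ⊆ N := fun z hz ↦ hαN (hz.imp id (Set.image_mono hTy ·))
  have hβfree : ∀ z ∈ β, G z ∉ β := by
    rintro z (hz | ⟨t, ht, rfl⟩) (hGz | ⟨s, hs, hsz⟩)
    · obtain ⟨h1, h2⟩ := hsph 1 one_pos (by omega) z (hseg _ hGy hz) (hseg _ hGy hGz)
      exact hG.apply_ne z ((hsphere _ hGy _ hGz h2).trans (hsphere _ hGy _ hz h1).symm)
    · exact hTS s hs (G.injective hsz ▸ hz)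
    · obtain ⟨h1, h2⟩ := hsph 2 two_pos (by omega) t (hseg _ hy (hTy ht)) (hseg _ hGy hGz)
      rw [hsphere _ hy t (hTy ht) h1] at hGz h2
      exact hG.apply_ne _ (hsphere _ hGy _ hGz h2)
    · have hs' := G.injective hsz
      rw [hs'] at hs
      obtain ⟨h1, h2⟩ := hsph 1 one_pos (by omega) t (hseg _ hy (hTy ht)) (hseg _ hy (hTy hs))
      exact hG.apply_ne t ((hsphere _ hy _ (hTy hs) h2).trans (hsphere _ hy _ (hTy ht) h1).symm)
  obtain ⟨U, hU, hUc, hβU, hUN, hUfree⟩ := exists_isPreconnected_free hβc hβp hN hβN hβfree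
  obtain ⟨h₁, hh₁, hh₁U, hG₁⟩ := hG.exists_push hU hUc hUfree
    (hβU (.inl (left_mem_segment ℝ x (G y)))) (hβU (.inr ⟨q, right_mem_segment ℝ y q, rfl⟩))
  have hOfix₁ : ∀ z ∈ O, h₁ z = z := fun z hz ↦ hh₁U z fun h ↦ hNO (hUN h) hz
  obtain ⟨h₂, hh₂, hh₂E, hG₂⟩ := hG₁.exists_push Metric.isOpen_ball
    (convex_ball (G x) ρ).isPreconnected
    (fun z hz hGz ↦ by
      rw [Homeomorph.trans_apply, hOfix₁ _ (hρE hz).2] at hGz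
      exact hNO (hρE hGz).1 (hρE hz).2)
    hqE (Metric.mem_ball_self hρ)
  have hOfix₂ : ∀ z ∈ O, h₂ z = z := fun z hz ↦ hh₂E z fun h ↦ hNO (hρE h).1 hz
  have hiter : ∀ j, j + 1 < n → ((G.trans h₁).trans h₂)^[j] (G x) = G^[j + 1] x := by
    intro j
    induction j with
    | zero => simp
    | succ j ih =>
      intro hj
      have hmem : G^[j + 1 + 1] x ∈ O := hKO ⟨j + 1 + 1, ⟨by omega, hj⟩, rfl⟩
      rw [Function.iterate_succ_apply', ih (by omega)]
      simp only [Homeomorph.trans_apply]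
      rw [← Function.iterate_succ_apply' G, hOfix₁ _ hmem, hOfix₂ _ hmem]
  obtain ⟨m, rfl⟩ : ∃ m, n = m + 1 + 1 := ⟨n - 2, by omega⟩
  refine hmin _ hG₂ (m + 1) (by omega) (by omega) (G x) ?_
  rw [Function.iterate_succ_apply', hiter m (by omega)]
  simp only [Homeomorph.trans_apply]
  rw [← Function.iterate_succ_apply' G, hper, hh₁, hh₂]

theorem exists_homeomorph_of_pairwise_disjoint {E : Type*} [NormedAddCommGroup E]
    [NormedSpace ℝ E] [CompleteSpace E] {m : ℕ} {U : ℕ → Set E} {p q : ℕ → E}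
    (hU : ∀ i < m, IsOpen (U i)) (hUc : ∀ i < m, IsPreconnected (U i))
    (hdisj : ∀ i < m, ∀ j < i, Disjoint (U i) (U j)) (hp : ∀ i < m, p i ∈ U i)
    (hq : ∀ i < m, q i ∈ U i) :
    ∃ h : E ≃ₜ E, (∃ C : ℝ, ∀ z, ‖h z - z‖ ≤ C) ∧ (∀ i < m, h (p i) = q i) ∧
      ∀ z, h z = z ∨ ∃ i < m, z ∈ U i ∧ h z ∈ U i := by
  induction m with
  | zero => exact ⟨Homeomorph.refl E, ⟨0, by simp⟩, by simp, fun z ↦ .inl rfl⟩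
  | succ m ih =>
    obtain ⟨h, ⟨C, hC⟩, hpq, hh⟩ := ih (fun i hi ↦ hU i (by omega)) (fun i hi ↦ hUc i (by omega))
      (fun i hi ↦ hdisj i (by omega)) (fun i hi ↦ hp i (by omega)) (fun i hi ↦ hq i (by omega))
    obtain ⟨g, hg, hgU, D, hD⟩ := canPush_of_isPreconnected (hU m (by omega)) (hUc m (by omega))
      (hp m (by omega)) (hq m (by omega))
    have hfix : ∀ z ∈ U m, h z = z := fun z hz ↦ (hh z).resolve_right fun ⟨i, hi, hzi, _⟩ ↦
      Set.disjoint_left.mp (hdisj m (by omega) i hi) hz hzi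
    have hgfix : ∀ i < m, ∀ z ∈ U i, g z = z := fun i hi z hz ↦ hgU z fun hzm ↦
      Set.disjoint_left.mp (hdisj m (by omega) i hi) hzm hz
    refine ⟨h.trans g, ⟨D + C, fun z ↦ ?_⟩, fun i hi ↦ ?_, fun z ↦ ?_⟩
    · exact (norm_sub_le_norm_sub_add_norm_sub _ (h z) _).trans (add_le_add (hD _) (hC _))
    · rcases Nat.lt_succ_iff_lt_or_eq.mp hi with hi' | rfl
      · simp [hpq i hi', hgfix i hi' _ (hq i hi)]
      · simp [hfix _ (hp i hi), hg]
    · simp only [Homeomorph.trans_apply]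
      by_cases hz : z ∈ U m
      · right
        refine ⟨m, by omega, hz, ?_⟩
        rw [hfix z hz]
        by_contra hgz
        exact hgz (by rwa [g.injective (hgU _ hgz)])
      · rcases hh z with hhz | ⟨i, hi, hzi, hhzi⟩
        · left; rw [hhz, hgU z hz]
        · exact .inr ⟨i, by omega, hzi, by rwa [hgfix i hi _ hhzi]⟩

/-- There is a closed `ε`-chain for `F` with `m` jumps. -/
def HasClosedChain {E : Type*} [PseudoMetricSpace E] (F : E → E) (ε : ℝ) (m : ℕ) : Prop :=
  ∃ x : ℕ → E, x 0 = x m ∧ ∀ i < m, dist (F (x i)) (x (i + 1)) < ε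

section Shortcut

variable {E : Type*} [PseudoMetricSpace E] {F : E → E} {ε : ℝ} {m i j : ℕ} {x : ℕ → E}

theorem hasClosedChain_of_skip (hx0 : x 0 = x m) (hx : ∀ i < m, dist (F (x i)) (x (i + 1)) < ε)
    (hij : i < j) (hj : j < m) (h : dist (F (x i)) (x (j + 1)) < ε) :
    HasClosedChain F ε (m - (j - i)) := by
  refine ⟨fun k ↦ if k ≤ i then x k else x (k + (j - i)), ?_, fun k hk ↦ ?_⟩
  · simp only [zero_le, if_true]
    rw [if_neg (by omega), hx0]
    congr 1; omega
  · rcases lt_trichotomy k i with hki | rfl | hki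
    · simp only [hki.le, Nat.succ_le_of_lt hki, if_true]
      exact hx k (by omega)
    · simp only [le_refl, if_true]
      rw [if_neg (by omega), show k + 1 + (j - k) = j + 1 by omega]
      exact h
    · simp only
      rw [if_neg (by omega), if_neg (by omega), show k + 1 + (j - i) = k + (j - i) + 1 by omega]
      exact hx _ (by omega)

theorem hasClosedChain_of_return (hx : ∀ i < m, dist (F (x i)) (x (i + 1)) < ε)
    (hij : i < j) (hj : j < m) (h : dist (F (x j)) (x (i + 1)) < ε) :
    HasClosedChain F ε (j - i) := by
  refine ⟨fun k ↦ if k < j - i then x (i + 1 + k) else x (i + 1), ?_, fun k hk ↦ ?_⟩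
  · simp [hij]
  · simp only [hk, if_true]
    split_ifs with hk'
    · exact hx _ (by omega)
    · rwa [show i + 1 + k = j by omega]

end Shortcut

/-- In a shortest closed chain the jumps cannot cross. -/
theorem exists_disjoint_segments {E : Type*} [NormedAddCommGroup E] [NormedSpace ℝ E] {F : E → E}
    {ε : ℝ} (h : ∃ m, 0 < m ∧ HasClosedChain F ε m) :
    ∃ (m : ℕ) (x : ℕ → E), 0 < m ∧ x 0 = x m ∧ (∀ i < m, dist (F (x i)) (x (i + 1)) < ε) ∧
      ∀ i < m, ∀ j < i,
        Disjoint (segment ℝ (F (x i)) (x (i + 1))) (segment ℝ (F (x j)) (x (j + 1))) := by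
  classical
  obtain ⟨hm, x, hx0, hx⟩ := Nat.find_spec h
  have hmin : ∀ k, 0 < k → k < Nat.find h → ¬ HasClosedChain F ε k := fun k hk hkm hc ↦
    Nat.find_min h hkm ⟨hk, hc⟩
  generalize Nat.find h = m at *
  refine ⟨m, x, hm, hx0, hx, fun i hi j hji ↦ Set.disjoint_left.mpr fun c hci hcj ↦ ?_⟩
  have h1 : ε ≤ dist (F (x j)) (x (i + 1)) := by
    by_contra! hlt
    exact hmin _ (by omega) (by omega) (hasClosedChain_of_skip hx0 hx hji hi hlt)
  have h2 : ε ≤ dist (F (x i)) (x (j + 1)) := by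
    by_contra! hlt
    exact hmin _ (by omega) (by omega) (hasClosedChain_of_return hx hji hi hlt)
  have h3 := dist_add_dist_of_mem_segment hci
  have h4 := dist_add_dist_of_mem_segment hcj
  have h5 := dist_triangle (F (x j)) c (x (i + 1))
  have h6 := dist_triangle (F (x i)) c (x (j + 1))
  linarith [hx i hi, hx j (by omega)]

theorem exists_periodic_of_hasClosedChain {E : Type*} [NormedAddCommGroup E] [NormedSpace ℝ E]
    [CompleteSpace E] {F : E ≃ₜ E} (hF : ∃ C : ℝ, ∀ z, ‖F z - z‖ ≤ C) {ε : ℝ}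
    (hFε : ∀ z, 2 * ε ≤ dist (F z) z) (h : ∃ m, 0 < m ∧ HasClosedChain F ε m) :
    ∃ G : E ≃ₜ E, IsBoundedFree G ∧ ∃ k, 0 < k ∧ ∃ z, G^[k] z = z := by
  obtain ⟨m, x, hm, hx0, hx, hdisj⟩ := exists_disjoint_segments h
  have hε : 0 < ε := dist_nonneg.trans_lt (hx 0 hm)
  let S : ℕ → Set E := fun i ↦ segment ℝ (F (x i)) (x (i + 1))
  obtain ⟨η, hη, hη0, hηε⟩ : ∃ η : ℝ, (∀ i < m, ∀ j < i,
      Disjoint (Metric.thickening η (S i)) (Metric.thickening η (S j))) ∧ 0 < η ∧ η < ε / 2 := by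
    have hev : ∀ i ∈ Set.Iio m, ∀ᶠ η : ℝ in 𝓝[>] 0, ∀ j ∈ Set.Iio i,
        Disjoint (Metric.thickening η (S i)) (Metric.thickening η (S j)) := fun i hi ↦ by
      rw [eventually_all_finite (Set.finite_Iio i)]
      intro j hj
      obtain ⟨η₀, hη₀, hd⟩ := (hdisj i hi j hj).exists_thickenings (isCompact_segment _ _)
        (isCompact_segment _ _).isClosed
      filter_upwards [Ioc_mem_nhdsGT hη₀] with η hη
      exact hd.mono (Metric.thickening_mono hη.2 _) (Metric.thickening_mono hη.2 _)
    exact (((eventually_all_finite (Set.finite_Iio m)).mpr hev).and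
      (Ioo_mem_nhdsGT (half_pos hε))).exists
  have hself : ∀ i, S i ⊆ Metric.thickening η (S i) := fun i ↦ Metric.self_subset_thickening hη0 _
  obtain ⟨g, ⟨C, hC⟩, hgx, hg⟩ := exists_homeomorph_of_pairwise_disjoint (m := m)
    (U := fun i ↦ Metric.thickening η (S i)) (p := fun i ↦ F (x i)) (q := fun i ↦ x (i + 1))
    (fun _ _ ↦ Metric.isOpen_thickening)
    (fun _ _ ↦ ((convex_segment _ _).thickening η).isPreconnected) hη
    (fun i _ ↦ hself i (left_mem_segment ℝ _ _)) (fun i _ ↦ hself i (right_mem_segment ℝ _ _))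
  obtain ⟨D, hD⟩ := hF
  refine ⟨F.trans g, ⟨⟨C + D, fun z ↦ ?_⟩, fun z hz ↦ ?_⟩, m, hm, x 0, ?_⟩
  · exact (norm_sub_le_norm_sub_add_norm_sub _ (F z) _).trans (add_le_add (hC _) (hD _))
  · rw [Homeomorph.trans_apply] at hz
    rcases hg (F z) with h | ⟨i, hi, h1, h2⟩
    · have := hFε z
      rw [← h, hz, dist_self] at this
      linarith
    · rw [hz] at h2
      obtain ⟨a, ha, haz⟩ := Metric.mem_thickening_iff.mp h1
      obtain ⟨b, hb, hbz⟩ := Metric.mem_thickening_iff.mp h2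
      have hab : dist a b ≤ dist (F (x i)) (x (i + 1)) := by
        have hsub : segment ℝ (F (x i)) (x (i + 1)) ⊆
            Metric.closedBall a (dist (F (x i)) (x (i + 1))) := by
          have h3 := dist_add_dist_of_mem_segment ha
          refine (convex_closedBall _ _).segment_subset ?_ ?_
          · rw [Metric.mem_closedBall]; linarith [dist_nonneg (x := a) (y := x (i + 1))]
          · rw [Metric.mem_closedBall, dist_comm]
            linarith [dist_nonneg (x := F (x i)) (y := a)]
        simpa [dist_comm] using hsub hb
      have h4 := dist_triangle4 (F z) a b z
      rw [dist_comm b z] at h4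
      linarith [hFε z, hx i hi]
  · have : ∀ j ≤ m, (F.trans g)^[j] (x 0) = x j := by
      intro j
      induction j with
      | zero => simp
      | succ j ih =>
        intro hj
        rw [Function.iterate_succ_apply', ih (by omega), Homeomorph.trans_apply, hgx j hj]
    rw [this m le_rfl, hx0]

theorem IsBoundedFree.iterate_ne {G : ℂ ≃ₜ ℂ} (hG : IsBoundedFree G) {n : ℕ} (hn : 0 < n) (z : ℂ) :
    G^[n] z ≠ z := by
  induction n using Nat.strong_induction_on generalizing G z with
  | _ n ih =>
    obtain rfl | rfl | hn3 : n = 1 ∨ n = 2 ∨ 3 ≤ n := by omega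
    · exact hG.apply_ne z
    · obtain ⟨C, hC⟩ := hG.bounded
      exact apply_apply_ne_of_forall_ne hC hG.apply_ne z
    · exact hG.iterate_ne_of_forall_lt hn3 (fun G' hG' k hk hkn w ↦ ih k hkn hG' hk w) z

theorem IsTorusLift.exists_mem_Icc {F : ℝ × ℝ → ℝ × ℝ} (hF : IsTorusLift F) (z : ℝ × ℝ) :
    ∃ w ∈ Set.Icc (0 : ℝ × ℝ) 1, F z - z = F w - w := by
  refine ⟨(Int.fract z.1, Int.fract z.2), ⟨⟨Int.fract_nonneg _, Int.fract_nonneg _⟩,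
    ⟨(Int.fract_lt_one _).le, (Int.fract_lt_one _).le⟩⟩, ?_⟩
  have h := hF (Int.fract z.1, Int.fract z.2) (⌊z.1⌋, ⌊z.2⌋)
  have hz : (Int.fract z.1, Int.fract z.2) + ((⌊z.1⌋ : ℝ), (⌊z.2⌋ : ℝ)) = z := by
    ext <;> simp
  simp only [hz] at h
  linear_combination h + hz

theorem IsTorusLift.exists_dist_bounds {F : ℝ × ℝ → ℝ × ℝ} (hF : IsTorusLift F)
    (hFc : Continuous F) (hfix : ∀ z, F z ≠ z) :
    ∃ δ > 0, ∃ C, ∀ z, δ ≤ dist (F z) z ∧ dist (F z) z ≤ C := by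
  have hc : ContinuousOn (fun z ↦ dist (F z) z) (Set.Icc (0 : ℝ × ℝ) 1) := by fun_prop
  have hne : (Set.Icc (0 : ℝ × ℝ) 1).Nonempty := ⟨0, by simp⟩
  obtain ⟨a, -, ha⟩ := isCompact_Icc.exists_isMinOn hne hc
  obtain ⟨b, -, hb⟩ := isCompact_Icc.exists_isMaxOn hne hc
  refine ⟨dist (F a) a, dist_pos.mpr (hfix a), dist (F b) b, fun z ↦ ?_⟩
  obtain ⟨w, hw, hzw⟩ := hF.exists_mem_Icc z
  rw [dist_eq_norm (F z), hzw, ← dist_eq_norm]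
  exact ⟨ha hw, hb hw⟩

/-- A homeomorphism of the plane that commutes with integer translations and has closed
`ε`-chains for every `ε` has a fixed point. -/
theorem IsTorusLift.exists_fixed_point {F : (ℝ × ℝ) ≃ₜ (ℝ × ℝ)} (hF : IsTorusLift F)
    (h : ∀ ε > 0, ∃ m, 0 < m ∧ HasClosedChain F ε m) : ∃ z, F z = z := by
  by_contra! hfix
  obtain ⟨δ, hδ, C, hFδ⟩ := hF.exists_dist_bounds F.continuous hfix
  obtain ⟨G, hG, k, hk, z, hz⟩ := exists_periodic_of_hasClosedChain (ε := δ / 2)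
    ⟨C, fun z ↦ dist_eq_norm (F z) z ▸ (hFδ z).2⟩ (fun z ↦ by linarith [(hFδ z).1])
    (h (δ / 2) (half_pos hδ))
  let e := Complex.equivRealProdCLM
  let G' : ℂ ≃ₜ ℂ := (e.toHomeomorph.trans G).trans e.symm.toHomeomorph
  have hG' : ∀ z, G' z = e.symm (G (e z)) := fun z ↦ rfl
  have hfree : IsBoundedFree G' := by
    obtain ⟨D, hD⟩ := hG.bounded
    refine ⟨⟨‖(e.symm : ℝ × ℝ →L[ℝ] ℂ)‖ * D, fun z ↦ ?_⟩, fun z hz ↦ ?_⟩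
    · have : G' z - z = (e.symm : ℝ × ℝ →L[ℝ] ℂ) (G (e z) - e z) := by simp [hG']
      rw [this]
      exact ContinuousLinearMap.le_opNorm_of_le _ (hD _)
    · refine hG.apply_ne (e z) ?_
      rw [hG', ContinuousLinearEquiv.symm_apply_eq] at hz
      exact hz
  refine hfree.iterate_ne hk (e.symm z) ?_
  have hsemi : Function.Semiconj e.symm G G' := fun w ↦ by simp [hG']
  rw [← (hsemi.iterate_right k).eq, hz]

theorem fixed_point_of_periodic_chains
    (f : Torus2 ≃ₜ Torus2) (F : (ℝ × ℝ) ≃ₜ (ℝ × ℝ))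
    (hlift : IsTorusLift F)
    (hproj : ∀ x : ℝ × ℝ, torusProj (F x) = f (torusProj x))
    (hchains : ∀ ε > (0 : ℝ), ∃ (n : ℕ) (x : ℕ → ℝ × ℝ),
      2 ≤ n ∧ x 0 = x (n - 1) ∧
      ∀ i < n - 1, dist (F (x i)) (x (i + 1)) < ε) :
    ∃ z : ℝ × ℝ, F z = z ∧ f (torusProj z) = torusProj z ∧
      Tendsto (fun n : ℕ => (n : ℝ)⁻¹ • (F^[n] z - z)) atTop (nhds 0) := by
  obtain ⟨z, hz⟩ := hlift.exists_fixed_point fun ε hε ↦ by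
    obtain ⟨n, x, hn, hx0, hx⟩ := hchains ε hε
    exact ⟨n - 1, by omega, x, hx0, hx⟩
  refine ⟨z, hz, by rw [← hproj, hz], ?_⟩
  simp [Function.iterate_fixed hz]
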